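/- arXiv:2104.11630 — 8 statements merged into one kernel-verified Lean document; each statement's English description precedes it below -/
import Mathlib

section
/- For every positive integer n, the quantity Q_n = 5πn/(5πn² − 16n + 4) − (Γ(n − 1/2)/Γ(n))² is strictly positive, where Γ denotes the Euler Gamma function. -/
open Real Set Filter Topology

theorem Q_pos (n : ℕ) (hn : 0 < n) :
    0 < 5*π*n / (5*π*n^2 - 16*n + 4) - (Real.Gamma ((n:ℝ) - 1/2) / Real.Gamma n)^2 := by
  have hx : (1:ℝ) ≤ n := by exact_mod_cast hn
  generalize (n:ℝ) = x at hx
  have h1 : 0 < Real.Gamma x := Real.Gamma_pos_of_pos (by linarith)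
  have h2 : 0 < Real.Gamma (x - 1/2) := Real.Gamma_pos_of_pos (by linarith)
  have e1 : Real.Gamma (x + 1) = x * Real.Gamma x := Real.Gamma_add_one (by linarith)
  have e2 : Real.Gamma (x - 1/2 + 1) = (x - 1/2) * Real.Gamma (x - 1/2) :=
    Real.Gamma_add_one (by linarith)
  have h := Real.Gamma_mul_add_mul_le_rpow_Gamma_mul_rpow_Gamma (s := x) (t := x + 1)
    (a := 1/2) (b := 1/2) (by linarith) (by linarith) (by norm_num) (by norm_num) (by norm_num)
  rw [show 1/2 * x + 1/2 * (x+1) = x - 1/2 + 1 by ring, e1, e2, ← Real.sqrt_eq_rpow,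
    ← Real.sqrt_eq_rpow, ← Real.sqrt_mul h1.le] at h
  have h3 : ((x - 1/2) * Real.Gamma (x - 1/2))^2 ≤ Real.Gamma x * (x * Real.Gamma x) := by
    rw [← Real.sq_sqrt (show 0 ≤ Real.Gamma x * (x * Real.Gamma x) by positivity)]
    exact pow_le_pow_left₀ (mul_nonneg (by linarith) h2.le) h 2
  have hp := Real.pi_lt_d2
  have hp3 := Real.pi_gt_three
  have hd : 0 < 5*π*x^2 - 16*x + 4 := by nlinarith [sq_nonneg (x - 1), mul_pos (sub_pos.2 hp3) (pow_pos (lt_of_lt_of_le one_pos hx) 2), Real.pi_gt_d2]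
  have hq : 0 < (x - 1/2)^2 := pow_pos (by linarith) 2
  have h4 : (Real.Gamma (x - 1/2) / Real.Gamma x)^2 ≤ x / (x - 1/2)^2 := by
    rw [div_pow, div_le_div_iff₀ (by positivity) hq]
    nlinarith
  have h5 : x / (x - 1/2)^2 < 5*π*x / (5*π*x^2 - 16*x + 4) := by
    rw [div_lt_div_iff₀ hq hd]
    have : 0 < x * ((16 - 5*π) * (x - 1/4)) :=
      mul_pos (by linarith) (mul_pos (by linarith) (by linarith))
    nlinarith
  linarith
end

section
/- For every positive integer n, (Γ(n − 1/2)/Γ(n))² < 4/(4n − 3), where Γ denotes the Euler Gamma function. -/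
open Real Set Filter Topology

theorem aux_step (k : ℕ) :
    (Real.Gamma ((k:ℝ) + 1/2) / Real.Gamma (k+1))^2 * (4*k+1) <
    (Real.Gamma (((k+1:ℕ):ℝ) + 1/2) / Real.Gamma ((k+1:ℕ)+1))^2 * (4*((k+1:ℕ):ℝ)+1) := by
  have hk : (0:ℝ) ≤ k := Nat.cast_nonneg k
  have e1 : Real.Gamma (((k+1:ℕ):ℝ) + 1/2) = ((k:ℝ)+1/2) * Real.Gamma ((k:ℝ)+1/2) := by
    rw [← Real.Gamma_add_one (by positivity)]; congr 1; push_cast; ring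
  have e2 : Real.Gamma (((k+1:ℕ):ℝ) + 1) = ((k:ℝ)+1) * Real.Gamma ((k:ℝ)+1) := by
    rw [← Real.Gamma_add_one (by positivity)]; congr 1; push_cast; ring
  rw [e1, e2, mul_div_mul_comm, mul_pow]
  have hp : 0 < (Real.Gamma ((k:ℝ) + 1/2) / Real.Gamma (k+1))^2 := by
    have := Real.Gamma_pos_of_pos (s := (k:ℝ)+1/2) (by positivity)
    have := Real.Gamma_pos_of_pos (s := (k:ℝ)+1) (by positivity)
    positivity
  have hq : (4*(k:ℝ)+1) < (((k:ℝ)+1/2)/(k+1))^2 * (4*((k+1:ℕ):ℝ)+1) := by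
    push_cast
    rw [div_pow, div_mul_eq_mul_div, lt_div_iff₀ (by positivity)]
    nlinarith
  nlinarith [mul_lt_mul_of_pos_left hq hp]

theorem aux_bound (k : ℕ) (hk0 : 0 < k) :
    (Real.Gamma ((k:ℝ) + 1/2) / Real.Gamma (k+1))^2 * (4*k+1) ≤ 4 + 1/(k:ℝ) := by
  have hk : (0:ℝ) < k := Nat.cast_pos.mpr hk0
  have g0 := Real.Gamma_pos_of_pos hk
  have g1 := Real.Gamma_pos_of_pos (s := (k:ℝ)+1) (by positivity)
  have gh := Real.Gamma_pos_of_pos (s := (k:ℝ)+1/2) (by positivity)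
  have h := Real.Gamma_mul_add_mul_le_rpow_Gamma_mul_rpow_Gamma (s := (k:ℝ)) (t := (k:ℝ)+1)
    (a := 1/2) (b := 1/2) hk (by positivity) (by norm_num) (by norm_num) (by norm_num)
  rw [show 1/2*(k:ℝ) + 1/2*((k:ℝ)+1) = k + 1/2 by ring, ← Real.sqrt_eq_rpow,
    ← Real.sqrt_eq_rpow] at h
  have h2 : Real.Gamma ((k:ℝ)+1/2)^2 ≤ Real.Gamma k * Real.Gamma (k+1) := by
    calc _ ≤ (√(Real.Gamma k) * √(Real.Gamma (k+1)))^2 := by gcongr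
      _ = _ := by rw [mul_pow, Real.sq_sqrt g0.le, Real.sq_sqrt g1.le]
  rw [Real.Gamma_add_one hk.ne'] at h2 ⊢
  have h3 : (Real.Gamma ((k:ℝ) + 1/2) / (k * Real.Gamma k))^2 ≤ 1/k := by
    rw [div_pow, div_le_div_iff₀ (by positivity) hk]
    nlinarith
  calc _ ≤ 1/(k:ℝ) * (4*k+1) := by gcongr
    _ = _ := by field_simp

theorem aux_lt (k : ℕ) :
    (Real.Gamma ((k:ℝ) + 1/2) / Real.Gamma (k+1))^2 * (4*k+1) < 4 := by
  have hm := strictMono_nat_of_lt_succ (f := fun k : ℕ =>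
    (Real.Gamma ((k:ℝ) + 1/2) / Real.Gamma (k+1))^2 * (4*k+1)) aux_step
  have hle : (fun k : ℕ =>
    (Real.Gamma ((k:ℝ) + 1/2) / Real.Gamma (k+1))^2 * (4*k+1)) (k+1) ≤ 4 := by
    have ht : Tendsto (fun m : ℕ => 4 + 1/(m:ℝ)) atTop (𝓝 (4+0)) :=
      tendsto_const_nhds.add tendsto_one_div_atTop_nhds_zero_nat
    rw [add_zero] at ht
    refine ge_of_tendsto ht ?_
    filter_upwards [eventually_ge_atTop (k+1)] with m hmk
    exact (hm.monotone hmk).trans (aux_bound m (by omega))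
  exact (hm (Nat.lt_succ_self k)).trans_le hle

theorem gamma_ratio_sq_lt (n : ℕ) (hn : 0 < n) :
    (Real.Gamma ((n:ℝ) - 1/2) / Real.Gamma n)^2 < 4 / (4*(n:ℝ) - 3) := by
  obtain ⟨k, rfl⟩ : ∃ k, n = k + 1 := ⟨n - 1, by omega⟩
  have h := aux_lt k
  have hk : (0:ℝ) ≤ k := Nat.cast_nonneg k
  push_cast
  rw [show (k:ℝ) + 1 - 1/2 = k + 1/2 by ring, show 4*((k:ℝ)+1) - 3 = 4*k+1 by ring,
    lt_div_iff₀ (by positivity)]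
  exact h
end

section
/- For every r ∈ (0,1), the function f(r) = (π/2)[16 − 5 log(1 − r²)] − [θ r² + K(r)][16 + (5π − 16)r²] admits the convergent series expansion f(r) = α r⁴ + Σ_{n=3}^∞ ((5πn² − 16n + 4) Q_n / (2n²)) r^{2n}, where Q_n = 5πn/(5πn² − 16n + 4) − (Γ(n − 1/2)/Γ(n))². -/
open Real Set Filter Topology

/-- The complete elliptic integral of the first kind. -/
noncomputable def K (r : ℝ) : ℝ :=
  ∫ t in (0:ℝ)..(π/2), (1 - r^2 * Real.sin t ^ 2) ^ (-(1:ℝ)/2)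

/-- The sequence `Q_n`. -/
noncomputable def Q (n : ℕ) : ℝ :=
  5*π*n / (5*π*n^2 - 16*n + 4) - (Real.Gamma ((n:ℝ) - 1/2) / Real.Gamma n)^2

/-- `θ = π(17 - 5π)/32`. -/
noncomputable def θ : ℝ := π * (17 - 5*π) / 32

noncomputable def f (r : ℝ) : ℝ :=
  (π/2) * (16 - 5 * Real.log (1 - r^2)) - (θ * r^2 + K r) * (16 + (5*π - 16) * r^2)

noncomputable def f₁ (r : ℝ) : ℝ := f r / r^4

noncomputable def cc (n : ℕ) : ℝ := ∏ i ∈ Finset.range n, (2 * (i : ℝ) + 1) / (2 * i + 2)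

lemma cc_succ (n : ℕ) : cc (n+1) = cc n * ((2 * (n : ℝ) + 1) / (2 * n + 2)) := by
  unfold cc; rw [Finset.prod_range_succ]

lemma cc_nonneg (n : ℕ) : 0 ≤ cc n := Finset.prod_nonneg fun i _ => by positivity

lemma cc_asc (n : ℕ) : (n.factorial : ℝ) * cc n = (ascPochhammer ℝ n).eval (1/2) := by
  induction n with
  | zero => simp [cc]
  | succ k ih =>
    rw [ascPochhammer_succ_eval, ← ih, cc_succ, Nat.factorial_succ]
    push_cast
    field_simp
    ring

lemma cc_choose (n : ℕ) : Ring.choose ((1/2 : ℝ) + n - 1) n = cc n := by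
  rw [← Ring.multichoose_eq]
  have h := Ring.factorial_nsmul_multichoose_eq_ascPochhammer (1/2 : ℝ) n
  rw [Polynomial.ascPochhammer_smeval_eq_eval, ← cc_asc, nsmul_eq_mul] at h
  exact mul_left_cancel₀ (by positivity) h

lemma cc_hasSum (x : ℝ) (hx : |x| < 1) :
    HasSum (fun n => cc n * x ^ n) ((1 - x) ^ (-(1:ℝ)/2)) := by
  have h := (Real.one_div_one_sub_rpow_hasFPowerSeriesOnBall_zero (1/2)).hasSum (y := x)
    (by simpa [enorm_eq_nnnorm, ← NNReal.coe_lt_coe] using hx)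
  have e : (1 - x) ^ (-(1:ℝ)/2) = 1 / (1 - (0 + x)) ^ ((1:ℝ)/2) := by
    rw [neg_div, Real.rpow_neg (by linarith [(abs_lt.1 hx).2]), zero_add, one_div, one_div]
  rw [e]
  convert! h using 2 with n
  rw [← cc_choose]
  simp [FormalMultilinearSeries.ofScalars, mul_comm]

lemma int_sin (n : ℕ) : ∫ t in (0:ℝ)..(π/2), Real.sin t ^ (2*n) = π/2 * cc n := by
  induction n with
  | zero => simp [cc]
  | succ k ih =>
    rw [mul_add, mul_one, integral_sin_pow, ih, cc_succ]
    simp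
    field_simp

lemma K_hasSum (r : ℝ) (h0 : 0 < r) (h1 : r < 1) :
    HasSum (fun n => π/2 * cc n ^ 2 * (r^2) ^ n) (K r) := by
  have hr2 : r^2 < 1 := by nlinarith
  have hb : ∀ t, r^2 * Real.sin t ^ 2 ≤ r^2 := fun t =>
    mul_le_of_le_one_right (by positivity) (Real.sin_sq_le_one t)
  have hb0 : ∀ t, 0 ≤ r^2 * Real.sin t ^ 2 := fun t => by positivity
  have hs : Summable (fun n => cc n * (r^2)^n) :=
    (cc_hasSum (r^2) (by rwa [abs_of_nonneg (by positivity)])).summable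
  have h := intervalIntegral.hasSum_integral_of_dominated_convergence
    (μ := MeasureTheory.volume) (a := 0) (b := π/2)
    (F := fun n t => cc n * (r^2 * Real.sin t ^ 2)^n)
    (f := fun t => (1 - r^2 * Real.sin t ^ 2) ^ (-(1:ℝ)/2))
    (fun n _ => cc n * (r^2)^n)
    (fun n => (by fun_prop : Continuous fun t => cc n * (r^2 * Real.sin t ^ 2)^n).aestronglyMeasurable)
    (fun n => MeasureTheory.ae_of_all _ fun t _ => by
      rw [Real.norm_of_nonneg (mul_nonneg (cc_nonneg n) (pow_nonneg (hb0 t) n))]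
      exact mul_le_mul_of_nonneg_left (pow_le_pow_left₀ (hb0 t) (hb t) n) (cc_nonneg n))
    (MeasureTheory.ae_of_all _ fun t _ => hs)
    intervalIntegrable_const
    (MeasureTheory.ae_of_all _ fun t _ => cc_hasSum _ (by
      rw [abs_of_nonneg (hb0 t)]; exact (hb t).trans_lt hr2))
  unfold K
  convert! h using 2 with n
  have : ∀ t, cc n * (r^2 * Real.sin t ^ 2)^n = cc n * (r^2)^n * Real.sin t ^ (2*n) := by
    intro t; rw [mul_pow, ← pow_mul (Real.sin t)]; ring
  simp only [this]
  rw [intervalIntegral.integral_const_mul, int_sin]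
  ring

lemma gam (n : ℕ) : Real.Gamma ((n:ℝ) + 1/2) / Real.Gamma (n+1) = √π * cc n := by
  induction n with
  | zero => simp [cc, -one_div, Real.Gamma_one_half_eq]
  | succ k ih =>
    have e : ((k+1 : ℕ) : ℝ) + 1/2 = (k + 1/2) + 1 := by push_cast; ring
    rw [e, Real.Gamma_add_one (by positivity), Real.Gamma_add_one (by positivity), mul_div_mul_comm,
      Nat.cast_succ, ih, cc_succ]
    field_simp

theorem f_series (r : ℝ) (hr : r ∈ Ioo (0:ℝ) 1) :
    HasSum (fun n : ℕ =>
        (5*π*((n:ℝ)+3)^2 - 16*((n:ℝ)+3) + 4) * Q (n+3) / (2*((n:ℝ)+3)^2) * r^(2*(n+3)))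
      (f r - (85*π/8 - 185*π^2/32 + 25*π^3/32) * r^4) := by
  obtain ⟨h0, h1⟩ := hr
  have hr2 : r^2 < 1 := by nlinarith
  have hL := (hasSum_nat_add_iff' 2).2
    (Real.hasSum_pow_div_log_of_abs_lt_one (x := r^2) (by rwa [abs_of_nonneg (by positivity)]))
  have hK := K_hasSum r h0 h1
  have hK3 := (hasSum_nat_add_iff' 3).2 hK
  have hK2 := ((hasSum_nat_add_iff' 2).2 hK).mul_left (r^2)
  have H := ((hL.mul_left (5*π/2)).sub (hK3.mul_left 16)).sub (hK2.mul_left (5*π-16))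
  convert! H using 1
  · funext n
    have hg : (Real.Gamma (((n+3:ℕ):ℝ) - 1/2) / Real.Gamma ((n+3:ℕ):ℝ))^2 = π * cc (n+2)^2 := by
      have := gam (n+2)
      have e1 : ((n+3:ℕ):ℝ) - 1/2 = ((n+2:ℕ):ℝ) + 1/2 := by push_cast; ring
      have e2 : ((n+3:ℕ):ℝ) = ((n+2:ℕ):ℝ) + 1 := by push_cast; ring
      rw [e1, e2, this, mul_pow, Real.sq_sqrt pi_pos.le]
    have hne : 5*π*((n:ℝ)+3)^2 - 16*((n:ℝ)+3) + 4 ≠ 0 := by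
      have := Real.pi_gt_three
      have hn : (0:ℝ) ≤ n := Nat.cast_nonneg n
      have : 15*((n:ℝ)+3)^2 ≤ 5*π*((n:ℝ)+3)^2 := by gcongr; linarith
      nlinarith
    have hc : cc (n+3) = cc (n+2) * ((2*(n:ℝ)+5)/(2*n+6)) := by
      rw [cc_succ]; push_cast; congr 2 <;> ring
    have hn3 : (n:ℝ)+3 ≠ 0 := by positivity
    have hn6 : 2*(n:ℝ)+6 ≠ 0 := by positivity
    have hq : (5*π*((n:ℝ)+3)^2 - 16*((n:ℝ)+3) + 4) * Q (n+3) =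
        5*π*(n+3) - (5*π*((n:ℝ)+3)^2 - 16*((n:ℝ)+3) + 4) * (π * cc (n+2)^2) := by
      unfold Q
      rw [hg, mul_sub]
      push_cast
      rw [mul_div_cancel₀ _ hne]
    rw [hq, hc, pow_mul]
    have e3 : (((n+2:ℕ):ℝ) + 1) = n+3 := by push_cast; ring
    have e6 : 2*(n:ℝ)+6 = 2*(n+3) := by ring
    rw [e3, e6]
    generalize cc (n+2) = c
    field_simp
    ring
  · have c0 : cc 0 = 1 := by simp [cc]
    have c1 : cc 1 = 1/2 := by rw [cc_succ, c0]; norm_num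
    have c2 : cc 2 = 3/8 := by rw [cc_succ, c1]; norm_num
    simp only [Finset.sum_range_succ, Finset.sum_range_zero, c0, c1, c2, f, θ]
    push_cast
    ring
end

section
/- The function f₁(r) = f(r)/r⁴ is strictly increasing on the interval (0,1). -/
open Real Set Filter Topology

lemma hasSum_congr_real {g h : ℕ → ℝ} {A : ℝ} (e : ∀ n, g n = h n) : HasSum g A ↔ HasSum h A := by
  rw [funext e]

noncomputable def pcoef (n : ℕ) : ℝ := ∏ i ∈ Finset.range n, (2 * (i : ℝ) + 1) / (2 * i + 2)

lemma pcoef_zero : pcoef 0 = 1 := by simp [pcoef]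

lemma pcoef_succ (n : ℕ) : pcoef (n+1) = pcoef n * ((2 * (n : ℝ) + 1) / (2 * n + 2)) := by
  rw [pcoef, Finset.prod_range_succ, ← pcoef]

lemma pcoef_pos (n : ℕ) : 0 < pcoef n := by
  unfold pcoef
  exact Finset.prod_pos fun i _ => by positivity

lemma pcoef_W (n : ℕ) : pcoef n ^ 2 * ((2 * n + 1) * Real.Wallis.W n) = 1 := by
  induction n with
  | zero => simp [pcoef_zero, Real.Wallis.W]
  | succ n ih =>
    rw [Real.Wallis.W_succ, pcoef_succ]
    refine Eq.trans ?_ ih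
    push_cast
    have h3 : 2 * ((n:ℝ) + 1) + 1 = 2 * n + 3 := by ring
    rw [h3]
    field_simp

lemma pcoef_bound (n : ℕ) : pcoef n ^ 2 * ((n : ℝ) + 1/4) ≤ 1 / π := by
  have hmono : Monotone (fun n : ℕ => pcoef n ^ 2 * ((n : ℝ) + 1/4)) := by
    apply monotone_nat_of_le_succ
    intro n
    rw [pcoef_succ, mul_pow, mul_assoc]
    apply mul_le_mul_of_nonneg_left _ (sq_nonneg _)
    rw [div_pow, div_mul_eq_mul_div, le_div_iff₀ (by positivity)]
    push_cast
    nlinarith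
  have hlim : Tendsto (fun n : ℕ => pcoef n ^ 2 * ((n : ℝ) + 1/4)) atTop (𝓝 (1/π)) := by
    have h1 : Tendsto (fun n : ℕ => (1/2 - (1/4) / (2 * (n:ℝ) + 1)) / Real.Wallis.W n)
        atTop (𝓝 ((1/2 - 0) / (π/2))) := by
      refine Tendsto.div (tendsto_const_nhds.sub ?_) Real.Wallis.tendsto_W_nhds_pi_div_two
        (by positivity)
      apply Tendsto.div_atTop tendsto_const_nhds
      apply tendsto_atTop_add_const_right
      exact tendsto_natCast_atTop_atTop.const_mul_atTop (by norm_num)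
    convert h1 using 1
    · ext n
      have := pcoef_W n
      have hW := Real.Wallis.W_pos n
      rw [eq_div_iff hW.ne']
      field_simp
      linear_combination (8 * (n:ℝ) + 2) * this
    · congr 1
      field_simp
      norm_num
  exact hmono.ge_of_tendsto hlim n

lemma integral_sin_half (n : ℕ) : ∫ t in (0:ℝ)..(π/2), Real.sin t ^ (2*n) = π/2 * pcoef n := by
  induction n with
  | zero => simp [pcoef_zero]
  | succ n ih =>
    rw [show 2 * (n+1) = 2*n + 2 by ring, integral_sin_pow, ih, pcoef_succ]
    simp
    ring

lemma choose_half (n : ℕ) : Ring.choose ((1/2:ℝ) + n - 1) n = pcoef n := by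
  rw [← Ring.multichoose_eq]
  have h := Ring.factorial_nsmul_multichoose_eq_ascPochhammer (1/2:ℝ) n
  have h2 : (ascPochhammer ℕ n).smeval (1/2:ℝ) = n.factorial * pcoef n := by
    rw [Polynomial.ascPochhammer_smeval_eq_eval]
    clear h
    induction n with
    | zero => simp [pcoef_zero]
    | succ n ih =>
      rw [ascPochhammer_succ_eval, ih, pcoef_succ, Nat.factorial_succ]
      push_cast
      field_simp
      ring
  rw [h2, nsmul_eq_mul] at h
  exact mul_left_cancel₀ (by positivity) h

lemma hasSum_rpow (x : ℝ) (hx : |x| < 1) :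
    HasSum (fun n => pcoef n * x ^ n) ((1 - x) ^ (-(1:ℝ)/2)) := by
  have h := (Real.one_div_one_sub_rpow_hasFPowerSeriesOnBall_zero (1/2)).hasSum
    (y := x) (by simpa [Metric.mem_eball, edist_dist, Real.dist_eq] using hx)
  simp only [choose_half] at h
  have e : (1 - x) ^ (-(1:ℝ)/2) = 1 / (1 - (0 + x)) ^ (1/2:ℝ) := by
    rw [neg_div, Real.rpow_neg (by linarith [(abs_lt.1 hx).2]), zero_add, one_div (_ ^ _)]
  rw [e]
  refine (hasSum_congr_real fun n => ?_).mpr h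
  simp [FormalMultilinearSeries.ofScalars, mul_comm]

lemma hasSum_K (r : ℝ) (hr : r ∈ Ioo (0:ℝ) 1) :
    HasSum (fun n => pcoef n ^ 2 * (r^2) ^ n) (K r / (π/2)) := by
  have hr2 : r^2 < 1 := by nlinarith [hr.1, hr.2]
  have hr2' : 0 ≤ r^2 := sq_nonneg r
  have h1 : HasSum (fun n : ℕ => ∫ t in (0:ℝ)..(π/2), pcoef n * (r^2 * Real.sin t ^ 2)^n) (K r) := by
    unfold K
    have hs := (hasSum_rpow (r^2) (by rw [abs_of_nonneg hr2']; exact hr2)).summable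
    apply intervalIntegral.hasSum_integral_of_dominated_convergence
      (fun n _ => pcoef n * (r^2) ^ n)
    · intro n
      exact (by fun_prop : Continuous fun t => pcoef n * (r^2 * Real.sin t ^ 2)^n).aestronglyMeasurable
    · intro n
      refine Eventually.of_forall fun t _ => ?_
      have := pcoef_pos n
      rw [Real.norm_of_nonneg (by positivity)]
      gcongr
      exact mul_le_of_le_one_right hr2' (Real.sin_sq_le_one t)
    · exact Eventually.of_forall fun t _ => hs
    · exact intervalIntegrable_const
    · refine Eventually.of_forall fun t _ => hasSum_rpow _ ?_
      rw [abs_of_nonneg (by positivity)]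
      exact (mul_le_of_le_one_right hr2' (Real.sin_sq_le_one t)).trans_lt hr2
  refine (hasSum_congr_real fun n => ?_).mpr (h1.div_const (π/2))
  have : ∀ t, pcoef n * (r^2 * Real.sin t ^ 2)^n = pcoef n * (r^2)^n * Real.sin t ^ (2*n) := by
    intro t
    rw [mul_pow, pow_mul (Real.sin t)]; ring
  simp only [this]
  rw [intervalIntegral.integral_const_mul, integral_sin_half]
  field_simp

noncomputable def dcoef (n : ℕ) : ℝ :=
  (π/2) * (5 / ((n:ℝ) + 2) - 16 * pcoef (n+2) ^ 2 - (5*π - 16) * pcoef (n+1) ^ 2)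

lemma dcoef_pos (n : ℕ) : 0 < dcoef n := by
  unfold dcoef
  apply mul_pos (by positivity)
  have hb := pcoef_bound (n+1)
  rw [le_div_iff₀ pi_pos] at hb
  have hp := pcoef_pos (n+1)
  rw [pcoef_succ (n+1)]
  set a := pcoef (n+1) with ha
  push_cast at hb ⊢
  have hpi := Real.pi_lt_d2
  have hn : (0:ℝ) ≤ n := Nat.cast_nonneg n
  have key : a^2 * (5 * π * ((n:ℝ)+2)^2 - 16 * (n+2) + 4) < 5 * (n+2) := by
    calc a^2 * (5 * π * ((n:ℝ)+2)^2 - 16 * (n+2) + 4)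
        < a^2 * (5 * π * (n+2) * (n + 1 + 1/4)) := by
          apply mul_lt_mul_of_pos_left _ (by positivity)
          nlinarith
      _ ≤ 5 * ((n:ℝ)+2) := by nlinarith
  have e : 5 / ((n:ℝ) + 2) - 16 * (a * ((2 * ((n:ℝ) + 1) + 1) / (2 * (n + 1) + 2))) ^ 2
      - (5*π - 16) * a ^ 2
      = (5 * (n+2) - a^2 * (5 * π * ((n:ℝ)+2)^2 - 16 * (n+2) + 4)) / (n+2)^2 := by
    have h2 : 2 * ((n:ℝ) + 1) + 2 = 2 * (n + 2) := by ring
    rw [h2]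
    field_simp
    ring
  rw [e]
  apply div_pos (by linarith) (by positivity)

lemma hasSum_f₁ (r : ℝ) (hr : r ∈ Ioo (0:ℝ) 1) :
    HasSum (fun n => dcoef n * (r^2) ^ n) (f₁ r + θ * (5*π - 16)) := by
  have hr2 : r^2 < 1 := by nlinarith [hr.1, hr.2]
  have hr0 : r ≠ 0 := hr.1.ne'
  have hS := hasSum_K r hr
  have hS1 := (hasSum_nat_add_iff' 1).2 hS
  have hS2 := (hasSum_nat_add_iff' 2).2 hS
  have hL := (hasSum_nat_add_iff' 1).2
    (hasSum_pow_div_log_of_abs_lt_one (x := r^2) (by rw [abs_of_nonneg (sq_nonneg r)]; exact hr2))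
  have H := ((((hL.mul_left 5).sub (hS2.mul_left 16)).sub
    (hS1.mul_left ((5*π-16) * r^2))).mul_left (π/2)).div_const (r^4)
  have e : ∀ A B : ℝ, A = B → HasSum (fun n => dcoef n * (r^2) ^ n) B →
    HasSum (fun n => dcoef n * (r^2) ^ n) A := fun A B h h' => h ▸ h'
  refine e _ _ ?_ ((hasSum_congr_real fun n => ?_).mpr H)
  rotate_left
  · unfold dcoef
    push_cast
    have h2 : (n:ℝ) + 1 + 1 = n + 2 := by ring
    rw [h2]
    have : (n:ℝ) + 2 ≠ 0 := by positivity
    field_simp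
    ring
  · simp only [f₁, f, θ, Finset.sum_range_succ, Finset.sum_range_zero, pcoef_succ, pcoef_zero]
    push_cast
    field_simp
    ring

theorem f₁_strictMonoOn : StrictMonoOn f₁ (Ioo (0:ℝ) 1) := by
  intro r hr s hs hrs
  have h1 := hasSum_f₁ r hr
  have h2 := hasSum_f₁ s hs
  have h0 := hr.1
  have hsq : r^2 < s^2 := by nlinarith
  have := hasSum_lt (i := 1) (fun n => ?_) ?_ h1 h2
  · linarith
  · have := dcoef_pos n
    dsimp only
    gcongr
  · have := dcoef_pos 1
    simp only [pow_one]
    gcongr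
end

section
/- The function f₁(r) = f(r)/r⁴ is strictly convex on the interval (0,1). -/
open Real Set Filter Topology

lemma cc_pos (n : ℕ) : 0 < cc n := Finset.prod_pos fun i _ => by positivity

lemma cc_le_one (n : ℕ) : cc n ≤ 1 :=
  Finset.prod_le_one (fun i _ => by positivity) fun i _ => by
    rw [div_le_one (by positivity)]; linarith

lemma choose_eq (n : ℕ) : Ring.choose (-(1:ℝ)/2) n = (-1)^n * cc n := by
  induction n with
  | zero => simp [cc]
  | succ n ih =>
    have h := Ring.descPochhammer_eq_factorial_smul_choose (-(1:ℝ)/2) (n+1)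
    have h0 := Ring.descPochhammer_eq_factorial_smul_choose (-(1:ℝ)/2) n
    rw [descPochhammer_succ_right, Polynomial.smeval_mul, h0, ih, Nat.factorial_succ] at h
    simp [Polynomial.smeval_sub, Polynomial.smeval_natCast] at h
    have hf : (n.factorial : ℝ) ≠ 0 := by positivity
    have h2 : ((n:ℝ)+1) * Ring.choose (-(1:ℝ)/2) (n+1) = (-1)^n * cc n * (-1/2 - n) := by
      apply mul_left_cancel₀ hf
      linarith
    rw [cc_succ]
    have : (n:ℝ)+1 ≠ 0 := by positivity
    apply mul_left_cancel₀ this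
    rw [h2]
    field_simp
    ring

lemma binom (x : ℝ) (hx : |x| < 1) :
    HasSum (fun n => cc n * x^n) ((1 - x) ^ (-(1:ℝ)/2)) := by
  have h := (Real.one_add_rpow_hasFPowerSeriesOnBall_zero (a := -(1:ℝ)/2)).hasSum (y := -x)
    (by simp [enorm_eq_nnnorm]; exact_mod_cast hx)
  simp only [binomialSeries_apply] at h
  have e : (1 + (0 + -x)) = 1 - x := by ring
  rw [e] at h
  have e2 : (fun n => cc n * x^n) =
      fun n => Ring.choose (-(1:ℝ)/2) n • (List.ofFn fun _ : Fin n => -x).prod := by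
    funext n
    have e3 : ((-1:ℝ)^n) * (-1)^n = 1 := by rw [← mul_pow]; simp
    rw [choose_eq, List.ofFn_const, List.prod_replicate, neg_pow x n, smul_eq_mul]
    linear_combination (-(cc n * x^n)) * e3
  rw [e2]
  exact h

lemma K_sum (r : ℝ) (h0 : 0 < r) (h1 : r < 1) :
    HasSum (fun n => cc n ^ 2 * (r^2)^n) (K r * (2/π)) := by
  have hr : r^2 < 1 := by nlinarith
  have key : HasSum (fun n => ∫ t in (0:ℝ)..(π/2), cc n * (r^2 * Real.sin t ^ 2)^n) (K r) := by
    unfold K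
    apply intervalIntegral.hasSum_integral_of_dominated_convergence (fun n _ => (r^2)^n)
    · intro n; exact Continuous.aestronglyMeasurable (by fun_prop)
    · intro n; refine .of_forall fun t _ => ?_
      rw [Real.norm_of_nonneg (mul_nonneg (cc_pos n).le (by positivity))]
      calc cc n * (r^2 * Real.sin t ^ 2)^n ≤ 1 * (r^2 * 1)^n := by
            gcongr
            · exact cc_le_one n
            · exact Real.sin_sq_le_one t
        _ = _ := by ring
    · exact .of_forall fun t _ => summable_geometric_of_lt_one (by positivity) hr
    · simp
    · refine .of_forall fun t _ => binom _ ?_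
      rw [abs_of_nonneg (by positivity)]
      nlinarith [Real.sin_sq_le_one t, sq_nonneg r]
  convert! key.mul_right (2/π) using 1
  funext n
  have : ∀ t, cc n * (r^2 * Real.sin t ^ 2)^n = cc n * (r^2)^n * Real.sin t ^ (2*n) := by
    intro t; rw [mul_pow, ← pow_mul (Real.sin t)]; ring
  simp only [this, intervalIntegral.integral_const_mul, int_sin]
  have := Real.pi_ne_zero
  field_simp

lemma wallis (n : ℕ) : Real.Wallis.W n * (cc n ^ 2 * (2 * n + 1)) = 1 := by
  induction n with
  | zero => simp [Real.Wallis.W, cc]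
  | succ n ih =>
    rw [Real.Wallis.W_succ, cc_succ]
    refine Eq.trans ?_ ih
    push_cast
    have : (2 * (n:ℝ) + 3) ≠ 0 := by positivity
    field_simp
    ring

lemma cc_bound (n : ℕ) : π * (n * cc n ^ 2) ≤ 1 := by
  have h := Real.Wallis.le_W n
  have hw := wallis n
  have hp : 0 < cc n ^ 2 * (2 * n + 1) := by have := cc_pos n; positivity
  have h2 := mul_le_mul_of_nonneg_right h hp.le
  rw [hw] at h2
  have h3 : ((2 : ℝ) * n + 1) / (2 * n + 2) * (π / 2) * (cc n ^ 2 * (2 * n + 1))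
     = π * cc n ^2 * ((2*n+1)^2/(4*(n+1))) := by field_simp; ring
  rw [h3] at h2
  refine le_trans ?_ h2
  have : (n:ℝ) ≤ (2*n+1)^2/(4*(n+1)) := by
    rw [le_div_iff₀ (by positivity)]; nlinarith
  have hp : 0 < π * cc n ^ 2 := by have := cc_pos n; positivity
  nlinarith

lemma coef_pos (n : ℕ) :
    0 < 5 / ((n:ℝ)+2) - 16 * cc (n+2) ^ 2 - (5*π-16) * cc (n+1) ^ 2 := by
  have hb := cc_bound (n+2)
  have hc := cc_succ (n+1)
  have hpi : 5*π - 16 < 0 := by linarith [Real.pi_lt_d2]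
  have hlt : cc (n+2) < cc (n+1) := by
    rw [hc]
    have : (2 * ((n+1:ℕ) : ℝ) + 1) / (2 * (n+1:ℕ) + 2) < 1 := by
      rw [div_lt_one (by positivity)]; linarith
    nlinarith [cc_pos (n+1)]
  have hlt2 : cc (n+2) ^ 2 < cc (n+1) ^ 2 := by
    have := cc_pos (n+2); gcongr
  have h5 : π * cc (n+2) ^ 2 ≤ 1 / ((n:ℝ)+2) := by
    rw [le_div_iff₀ (by positivity)]
    push_cast at hb
    linarith
  have h6 : 5 / ((n:ℝ)+2) = 5 * (1/((n:ℝ)+2)) := by ring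
  rw [h6]
  nlinarith

noncomputable def bb (n : ℕ) : ℝ :=
  (π/2) * (5 / ((n:ℝ)+2) - 16 * cc (n+2) ^ 2 - (5*π-16) * cc (n+1) ^ 2)

lemma f₁_sum (r : ℝ) (h0 : 0 < r) (h1 : r < 1) :
    HasSum (fun n => bb n * r^(2*n)) (f₁ r + θ * (5*π-16)) := by
  have hr : r^2 < 1 := by nlinarith
  have hl := Real.hasSum_pow_div_log_of_abs_lt_one (x := r^2)
    (by rwa [abs_of_nonneg (by positivity)])
  have hk := K_sum r h0 h1
  have hl1 := (hasSum_nat_add_iff' 1).mpr hl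
  have hk1 := (hasSum_nat_add_iff' 1).mpr hk
  have hk2 := (hasSum_nat_add_iff' 2).mpr hk
  have H := (((hl1.mul_left 5).sub (hk2.mul_left 16)).sub
    (hk1.mul_left ((5*π-16)*r^2))).mul_left (π/2 / r^4)
  have hr0 : r ≠ 0 := h0.ne'
  have := Real.pi_ne_zero
  convert! H using 1
  · funext n
    unfold bb
    push_cast
    rw [show (n:ℝ)+1+1 = n+2 by ring]
    field_simp
    ring
  · simp [Finset.sum_range_succ, f₁, f, cc, θ]
    field_simp
    ring

theorem f₁_strictConvexOn : StrictConvexOn ℝ (Ioo (0:ℝ) 1) f₁ := by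
  refine ⟨convex_Ioo 0 1, fun x hx y hy hxy a b ha hb hab => ?_⟩
  have hz := convex_Ioo (0:ℝ) 1 hx hy ha.le hb.le hab
  have bpos : ∀ n, 0 < bb n := fun n => mul_pos (by positivity) (coef_pos n)
  have Hx := (f₁_sum x hx.1 hx.2).mul_left a
  have Hy := (f₁_sum y hy.1 hy.2).mul_left b
  have Hz := f₁_sum _ hz.1 hz.2
  have := hasSum_lt (i := 1) (fun n => ?_) ?_ Hz (Hx.add Hy)
  · simp only [smul_eq_mul] at this ⊢
    have e : θ * (5*π-16) = a * (θ * (5*π-16)) + b * (θ * (5*π-16)) := by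
      rw [← add_mul, hab, one_mul]
    linarith
  · have h := ((even_two_mul n).convexOn_pow (𝕜 := ℝ)).2 (mem_univ x) (mem_univ y) ha.le hb.le hab
    simp only [smul_eq_mul] at h ⊢
    nlinarith [mul_le_mul_of_nonneg_left h (bpos n).le]
  · have h := ((even_two_mul 1).strictConvexOn_pow (by norm_num)).2 (mem_univ x) (mem_univ y) hxy ha hb hab
    simp only [smul_eq_mul] at h ⊢
    nlinarith [mul_lt_mul_of_pos_left h (bpos 1)]
end

section
/- The function f₁(r) = f(r)/r⁴ tends to α = 85π/8 − 185π²/32 + 25π³/32 as r tends to 0 from the right within (0,1). -/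
open Real Set Filter Topology

lemma w_bound (u : ℝ) (h0 : 0 ≤ u) (h1 : u ≤ 1/4) :
    |(1 - u) ^ (-(1:ℝ)/2) - (1 + u/2 + 3*u^2/8)| ≤ u^3 := by
  have hpos : 0 < 1 - u := by linarith
  set w := (1 - u) ^ (-(1:ℝ)/2) with hw
  have hwpos : 0 < w := Real.rpow_pos_of_pos hpos _
  have hw2 : w^2 * (1 - u) = 1 := by
    rw [hw, ← Real.rpow_natCast, ← Real.rpow_mul hpos.le]
    norm_num
    rw [Real.rpow_neg_one]
    field_simp
  have hu3 : 0 ≤ u^3 := by positivity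
  have hu4 : 0 ≤ u^4 := by positivity
  have hu5 : 0 ≤ u^5 := by positivity
  have hlow : 1 + u/2 + 3*u^2/8 ≤ w := by
    refine (sq_le_sq₀ (by positivity) hwpos.le).1 ?_
    apply le_of_mul_le_mul_right _ hpos
    rw [hw2]
    nlinarith
  have hup : w ≤ 1 + u/2 + 3*u^2/8 + u^3 := by
    refine (sq_le_sq₀ hwpos.le (by positivity)).1 ?_
    apply le_of_mul_le_mul_right _ hpos
    rw [hw2]
    have e : (1 + u/2 + 3*u^2/8 + u^3)^2 * (1-u) - 1
      = u^3 * (11/8 - 79/64*u - 25/64*u^2 + u^3/4 - u^4) := by ring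
    have : 0 ≤ u^3 * (11/8 - 79/64*u - 25/64*u^2 + u^3/4 - u^4) := by
      apply mul_nonneg hu3
      have : u^2 ≤ 1/16 := by nlinarith
      have : u^4 ≤ 1 := pow_le_one₀ h0 (by linarith)
      nlinarith [pow_le_pow_left₀ h0 h1 4]
    linarith
  rw [abs_le]; constructor <;> linarith

lemma K_bound (r : ℝ) (h0 : 0 < r) (h1 : r < 1/2) :
    |K r - (π/2 + π/8 * r^2 + 9*π/128 * r^4)| ≤ π/2 * r^6 := by
  have hr2 : r^2 ≤ 1/4 := by nlinarith
  have hu : ∀ t : ℝ, 0 ≤ r^2 * sin t ^ 2 ∧ r^2 * sin t ^ 2 ≤ r^2 := fun t =>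
    ⟨by positivity, by nlinarith [sin_sq_le_one t, sq_nonneg r]⟩
  have hc : Continuous fun t : ℝ => (1 - r^2 * Real.sin t ^ 2) ^ (-(1:ℝ)/2) := by
    apply Continuous.rpow_const (by fun_prop)
    intro t; left; have := (hu t).2; linarith
  have hc2 : Continuous fun t : ℝ => 1 + (r^2 * Real.sin t ^ 2)/2 + 3*(r^2 * Real.sin t ^ 2)^2/8 := by
    fun_prop
  have s2 : ∫ t in (0:ℝ)..(π/2), sin t ^ 2 = π/4 := by
    rw [integral_sin_sq]; simp; ring
  have s4 : ∫ t in (0:ℝ)..(π/2), sin t ^ 4 = 3*π/16 := by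
    have := integral_sin_pow (a := 0) (b := π/2) 2
    norm_num [s2] at this
    rw [this]; ring
  have hP : ∫ t in (0:ℝ)..(π/2), (1 + (r^2 * Real.sin t ^ 2)/2 + 3*(r^2 * Real.sin t ^ 2)^2/8)
      = π/2 + π/8 * r^2 + 9*π/128 * r^4 := by
    have : (fun t : ℝ => 1 + (r^2 * Real.sin t ^ 2)/2 + 3*(r^2 * Real.sin t ^ 2)^2/8)
      = fun t => (1 + r^2/2 * sin t ^ 2) + 3*r^4/8 * sin t ^ 4 := by
      funext t; ring
    rw [this, intervalIntegral.integral_add, intervalIntegral.integral_add,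
      intervalIntegral.integral_const_mul, intervalIntegral.integral_const_mul, s2, s4]
    · simp; ring
    all_goals exact Continuous.intervalIntegrable (by fun_prop) _ _
  rw [← hP, K, ← intervalIntegral.integral_sub (hc.intervalIntegrable _ _) (hc2.intervalIntegrable _ _)]
  have := intervalIntegral.norm_integral_le_of_norm_le_const (a := 0) (b := π/2) (C := r^6)
    (f := fun t : ℝ => (1 - r^2 * Real.sin t ^ 2) ^ (-(1:ℝ)/2) - (1 + (r^2 * Real.sin t ^ 2)/2 + 3*(r^2 * Real.sin t ^ 2)^2/8)) (by
      intro t _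
      rw [Real.norm_eq_abs]
      refine (w_bound _ (hu t).1 ((hu t).2.trans hr2)).trans ?_
      calc (r^2 * sin t ^ 2)^3 ≤ (r^2)^3 := pow_le_pow_left₀ (hu t).1 (hu t).2 3
        _ = r^6 := by ring)
  rw [Real.norm_eq_abs, sub_zero, abs_of_pos (by positivity : (0:ℝ) < π/2)] at this
  linarith

lemma log_bound (r : ℝ) (h0 : 0 < r) (h1 : r < 1/2) :
    |Real.log (1 - r^2) + r^2 + r^4/2| ≤ 2 * r^6 := by
  have hr2 : r^2 ≤ 1/4 := by nlinarith
  have h := Real.abs_log_sub_add_sum_range_le (x := r^2) (by rw [abs_of_nonneg (by positivity)]; linarith) 2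
  rw [abs_of_nonneg (by positivity : 0 ≤ r^2)] at h
  simp [Finset.sum_range_succ] at h
  have e : Real.log (1 - r^2) + r^2 + r^4/2 = r ^ 2 + (r ^ 2) ^ 2 / (1 + 1) + log (1 - r ^ 2) := by ring
  rw [e]
  refine h.trans ?_
  rw [div_le_iff₀ (by linarith)]
  nlinarith [pow_pos h0 6]

theorem f₁_tendsto_zero :
    Tendsto f₁ (𝓝[Ioo (0:ℝ) 1] 0) (𝓝 ((85*π/8 - 185*π^2/32 + 25*π^3/32))) := by
  have hid : Tendsto (fun r : ℝ => r) (𝓝[Ioo (0:ℝ) 1] 0) (𝓝 0) :=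
    tendsto_id.mono_left nhdsWithin_le_nhds
  have ev : ∀ᶠ r in 𝓝[Ioo (0:ℝ) 1] 0, 0 < r ∧ r < 1/2 := by
    filter_upwards [self_mem_nhdsWithin, hid.eventually (gt_mem_nhds (by norm_num : (0:ℝ) < 1/2))] with r a b
    exact ⟨a.1, b⟩
  have sq : ∀ C : ℝ, Tendsto (fun r : ℝ => C * r^2) (𝓝[Ioo (0:ℝ) 1] 0) (𝓝 0) := fun C => by
    simpa using (hid.pow 2).const_mul C
  have hE : Tendsto (fun r => (K r - (π/2 + π/8 * r^2 + 9*π/128 * r^4)) / r^4) (𝓝[Ioo (0:ℝ) 1] 0) (𝓝 0) := by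
    apply squeeze_zero_norm' _ (sq (π/2))
    filter_upwards [ev] with r hr
    have h4 := pow_pos hr.1 4
    rw [Real.norm_eq_abs, abs_div, abs_of_pos h4, div_le_iff₀ h4]
    refine (K_bound r hr.1 hr.2).trans (le_of_eq (by ring))
  have hL : Tendsto (fun r => (Real.log (1 - r^2) + r^2 + r^4/2) / r^4) (𝓝[Ioo (0:ℝ) 1] 0) (𝓝 0) := by
    apply squeeze_zero_norm' _ (sq 2)
    filter_upwards [ev] with r hr
    have h4 := pow_pos hr.1 4
    rw [Real.norm_eq_abs, abs_div, abs_of_pos h4, div_le_iff₀ h4]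
    refine (log_bound r hr.1 hr.2).trans (le_of_eq (by ring))
  have main := (((sq (-(9*π/128*(5*π-16)))).const_add (85*π/8 - 185*π^2/32 + 25*π^3/32)).sub
    (hL.const_mul (5*π/2))).sub (hE.mul ((sq (5*π-16)).const_add 16))
  simp only [add_zero, mul_zero, sub_zero, zero_mul] at main
  refine main.congr' ?_
  filter_upwards [ev] with r hr
  have := hr.1.ne'
  simp only [f₁, f, θ]
  field_simp
  ring
end

section
/- The function f₁(r) = f(r)/r⁴ tends to β = (8 − 10 log 2)π − 85π²/32 + 25π³/32 as r tends to 1 from the left within (0,1). -/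
open Real Set Filter Topology

lemma K_aux_int (r : ℝ) (h0 : 0 < r) (h1 : r < 1) :
    IntervalIntegrable (fun t => r * Real.sin t / √(1 - r^2 * Real.sin t ^ 2))
      MeasureTheory.volume 0 (π/2) ∧
    ∫ t in (0:ℝ)..(π/2), r * Real.sin t / √(1 - r^2 * Real.sin t ^ 2)
      = Real.log (1 + r) - Real.log (1 - r^2) / 2 := by
  have hpos : ∀ t : ℝ, 0 < 1 - r^2 * Real.sin t ^ 2 := by
    intro t
    have := Real.sin_sq_le_one t
    nlinarith [sq_nonneg (Real.sin t)]
  have hint : IntervalIntegrable (fun t => r * Real.sin t / √(1 - r^2 * Real.sin t ^ 2))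
      MeasureTheory.volume 0 (π/2) := by
    apply Continuous.intervalIntegrable
    apply Continuous.div (by fun_prop) (by fun_prop)
    intro t
    exact (Real.sqrt_pos.2 (hpos t)).ne'
  refine ⟨hint, ?_⟩
  have key : ∀ t ∈ uIcc (0:ℝ) (π/2), HasDerivAt
      (fun t => - Real.log (r * Real.cos t + √(1 - r^2 * Real.sin t ^ 2)))
      (r * Real.sin t / √(1 - r^2 * Real.sin t ^ 2)) t := by
    intro t ht
    rw [uIcc_of_le (by positivity)] at ht
    have hc : 0 ≤ Real.cos t :=
      Real.cos_nonneg_of_mem_Icc ⟨by linarith [ht.1, Real.pi_pos], ht.2⟩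
    have hS := Real.sqrt_pos.2 (hpos t)
    have hsum : 0 < r * Real.cos t + √(1 - r^2 * Real.sin t ^ 2) := by positivity
    have d1 := (((Real.hasDerivAt_sin t).pow 2).const_mul (r^2)).const_sub 1
    have d2 := d1.sqrt (hpos t).ne'
    have d3 := ((((Real.hasDerivAt_cos t).const_mul r).add d2).log hsum.ne').neg
    refine d3.congr_deriv ?_
    simp only [Pi.pow_apply, Pi.add_apply] at *
    field_simp
    simp
    ring
  rw [intervalIntegral.integral_eq_sub_of_hasDerivAt key hint]
  have : 0 < 1 - r^2 := by nlinarith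
  simp [Real.log_sqrt this.le]
  rw [add_comm r 1]; ring

lemma K_eq (r : ℝ) (h0 : 0 < r) (h1 : r < 1) :
    K r + Real.log (1 - r^2) / 2 = Real.log (1 + r) +
      ∫ t in (0:ℝ)..(π/2), √((1 - r * Real.sin t) / (1 + r * Real.sin t)) := by
  obtain ⟨hi, he⟩ := K_aux_int r h0 h1
  have hm : ∀ t : ℝ, 0 < 1 - r * Real.sin t := fun t => by
    nlinarith [Real.sin_le_one t]
  have hp : ∀ t : ℝ, 0 < 1 + r * Real.sin t := fun t => by
    nlinarith [Real.neg_one_le_sin t]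
  have hi2 : IntervalIntegrable (fun t => √((1 - r * Real.sin t) / (1 + r * Real.sin t)))
      MeasureTheory.volume 0 (π/2) := by
    apply Continuous.intervalIntegrable
    apply Continuous.sqrt
    exact Continuous.div (by fun_prop) (by fun_prop) (fun t => (hp t).ne')
  have : K r = (∫ t in (0:ℝ)..(π/2), r * Real.sin t / √(1 - r^2 * Real.sin t ^ 2)) +
      ∫ t in (0:ℝ)..(π/2), √((1 - r * Real.sin t) / (1 + r * Real.sin t)) := by
    rw [← intervalIntegral.integral_add hi hi2, K]
    congr 1
    ext t
    have e : 1 - r^2 * Real.sin t ^ 2 = (1 - r * Real.sin t) * (1 + r * Real.sin t) := by ring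
    have e2 : (-(1:ℝ)/2) = -(1/2) := by norm_num
    rw [e2, Real.rpow_neg (by rw [e]; exact (mul_pos (hm t) (hp t)).le), ← Real.sqrt_eq_rpow, e,
      Real.sqrt_mul (hm t).le, Real.sqrt_div (hm t).le]
    have a := Real.sqrt_pos.2 (hm t)
    have b := Real.sqrt_pos.2 (hp t)
    have a2 := Real.sq_sqrt (hm t).le
    field_simp
    rw [a2]; ring
  rw [this, he]; ring

lemma int_one : ∫ t in (0:ℝ)..(π/2), √((1 - 1 * Real.sin t) / (1 + 1 * Real.sin t))
    = Real.log 2 := by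
  have hs : ∀ t ∈ uIcc (0:ℝ) (π/2), 0 < 1 + Real.sin t ∧ 0 ≤ Real.cos t := by
    intro t ht
    rw [uIcc_of_le (by positivity)] at ht
    have hc : 0 ≤ Real.cos t :=
      Real.cos_nonneg_of_mem_Icc ⟨by linarith [ht.1, Real.pi_pos], ht.2⟩
    have := Real.sin_nonneg_of_mem_Icc ⟨ht.1, by linarith [ht.2, Real.pi_pos]⟩
    exact ⟨by linarith, hc⟩
  have : ∫ t in (0:ℝ)..(π/2), √((1 - 1 * Real.sin t) / (1 + 1 * Real.sin t))
      = ∫ t in (0:ℝ)..(π/2), Real.cos t / (1 + Real.sin t) := by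
    apply intervalIntegral.integral_congr
    intro t ht
    obtain ⟨h1, h2⟩ := hs t ht
    simp only [one_mul]
    have e : (1 - Real.sin t) / (1 + Real.sin t) = (Real.cos t / (1 + Real.sin t))^2 := by
      rw [div_pow, Real.cos_sq']
      field_simp
      ring
    rw [e, Real.sqrt_sq (by positivity)]
  rw [this, intervalIntegral.integral_eq_sub_of_hasDerivAt
    (f := fun t => Real.log (1 + Real.sin t))]
  · simp; norm_num
  · intro t ht
    exact ((Real.hasDerivAt_sin t).const_add 1).log (hs t ht).1.ne'
  · apply ContinuousOn.intervalIntegrable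
    exact ContinuousOn.div (by fun_prop) (by fun_prop) (fun t ht => (hs t ht).1.ne')

lemma int_tendsto : Tendsto (fun r : ℝ =>
    ∫ t in (0:ℝ)..(π/2), √((1 - r * Real.sin t) / (1 + r * Real.sin t)))
    (𝓝[Ioo (0:ℝ) 1] 1) (𝓝 (Real.log 2)) := by
  rw [← int_one]
  apply intervalIntegral.tendsto_integral_filter_of_dominated_convergence (fun _ => (1:ℝ))
  · refine Eventually.of_forall fun r => ?_
    exact (by fun_prop : Measurable fun t => √((1 - r * Real.sin t) / (1 + r * Real.sin t))).aestronglyMeasurable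
  · filter_upwards [self_mem_nhdsWithin] with r hr
    refine Eventually.of_forall fun t ht => ?_
    rw [uIoc_of_le (by positivity)] at ht
    have := Real.sin_nonneg_of_mem_Icc ⟨ht.1.le, by linarith [ht.2, Real.pi_pos]⟩
    have := mul_nonneg hr.1.le this
    rw [Real.norm_of_nonneg (Real.sqrt_nonneg _)]
    apply Real.sqrt_le_one.2
    rw [div_le_one (by linarith)]; linarith
  · simp
  · refine Eventually.of_forall fun t ht => ?_
    rw [uIoc_of_le (by positivity)] at ht
    have := Real.sin_nonneg_of_mem_Icc ⟨ht.1.le, by linarith [ht.2, Real.pi_pos]⟩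
    apply Tendsto.mono_left _ nhdsWithin_le_nhds
    have : ContinuousAt (fun r => √((1 - r * Real.sin t) / (1 + r * Real.sin t))) 1 := by
      apply ContinuousAt.sqrt
      exact ContinuousAt.div (by fun_prop) (by fun_prop) (by linarith)
    exact this

theorem f₁_tendsto_one :
    Tendsto f₁ (𝓝[Ioo (0:ℝ) 1] 1) (𝓝 (((8 - 10 * Real.log 2) * π - 85*π^2/32 + 25*π^3/32))) := by
  have hG : Tendsto (fun r : ℝ => K r + Real.log (1 - r^2) / 2) (𝓝[Ioo (0:ℝ) 1] 1)
      (𝓝 (Real.log (1 + 1) + Real.log 2)) := by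
    have hl : Tendsto (fun r : ℝ => Real.log (1 + r)) (𝓝[Ioo (0:ℝ) 1] 1)
        (𝓝 (Real.log (1 + 1))) := by
      apply Tendsto.mono_left _ nhdsWithin_le_nhds
      exact ContinuousAt.log (f := fun r : ℝ => 1 + r) (by fun_prop) (by norm_num)
    refine (hl.add int_tendsto).congr' ?_
    filter_upwards [self_mem_nhdsWithin] with r hr
    exact (K_eq r hr.1 hr.2).symm
  have hx : Tendsto (fun r : ℝ => (1 - r^2) * Real.log (1 - r^2)) (𝓝[Ioo (0:ℝ) 1] 1)
      (𝓝 ((1 - 1^2) * Real.log (1 - 1^2))) := by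
    apply Tendsto.mono_left _ nhdsWithin_le_nhds
    exact (Real.continuous_mul_log.comp (by fun_prop : Continuous fun r : ℝ => 1 - r^2)).tendsto 1
  have hr : Tendsto (fun r : ℝ => r) (𝓝[Ioo (0:ℝ) 1] 1) (𝓝 1) :=
    tendsto_id.mono_left nhdsWithin_le_nhds
  have hmain := ((((hG.mul ((hr.pow 2).const_mul (5*π-16) |>.const_add 16)).const_sub (8*π)).sub
    ((((hr.pow 2).const_mul θ)).mul ((hr.pow 2).const_mul (5*π-16) |>.const_add 16))).add
    (hx.const_mul ((16 - 5*π)/2))).div (hr.pow 4) (by norm_num)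
  convert hmain.congr ?_ using 2
  rotate_left
  · intro r
    simp only [f₁, f, Pi.div_apply]
    congr 1
    ring
  · congr 1
    simp only [θ]
    norm_num
    ring
end

section
/- The function g₁(r) = g(r)/r² tends to δ = 128/5 − 32 log 2 − 17π/2 + 5π²/2 as r tends to 0 from the right within (0,1). -/
open Real Set Filter Topology

/-- `lam = 8/5 - log 4`. -/
noncomputable def lam : ℝ := 8/5 - Real.log 4

noncomputable def g (r : ℝ) : ℝ :=
  (lam * r^2 + K r) * (16 + (5*π - 16) * r^2) - (π/2) * (16 - 5 * Real.log (1 - r^2))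

noncomputable def g₁ (r : ℝ) : ℝ := g r / r^2

lemma aux_rpow (u : ℝ) (hu : u ≤ 1/2) : (1 - u) ^ (-(1:ℝ)/2) = (√(1-u))⁻¹ := by
  rw [neg_div, Real.rpow_neg (by linarith), Real.sqrt_eq_rpow]

lemma aux_bound_s13 (u : ℝ) (h0 : 0 ≤ u) (hu : u ≤ 1/2) :
    1 + u/2 ≤ (1 - u) ^ (-(1:ℝ)/2) ∧ (1 - u) ^ (-(1:ℝ)/2) ≤ 1 + u/2 + u^2 := by
  rw [aux_rpow u hu]
  have hs : 0 < √(1-u) := Real.sqrt_pos.2 (by linarith)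
  have hsq : √(1-u)^2 = 1-u := Real.sq_sqrt (by linarith)
  constructor
  · rw [le_inv_comm₀ (by positivity) hs]
    apply Real.sqrt_le_iff.2 ⟨by positivity, ?_⟩
    rw [inv_pow, ← one_div, le_div_iff₀ (by positivity)]
    nlinarith [sq_nonneg u, pow_nonneg h0 3]
  · rw [inv_le_comm₀ hs (by positivity)]
    apply Real.le_sqrt_of_sq_le
    rw [inv_pow, ← one_div, div_le_iff₀ (by positivity)]
    have h2 : 0 ≤ u^2 := sq_nonneg u
    have h3 : u^3 ≤ u^2 * (1/2) := by nlinarith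
    have h5 : u^5 ≤ u^3 * (1/4) := by
      have : 0 ≤ u^3 * (1/4 - u^2) := mul_nonneg (by positivity) (by nlinarith)
      nlinarith
    nlinarith

lemma aux_K (r : ℝ) (h0 : 0 < r) (hr : r < 1/2) :
    π/2 + π/8 * r^2 ≤ K r ∧ K r ≤ π/2 + π/8*r^2 + r^4 * (π/2) := by
  have hpi := Real.pi_pos
  have hu : ∀ t : ℝ, 0 ≤ r^2 * sin t^2 ∧ r^2 * sin t^2 ≤ r^2 ∧ r^2 ≤ 1/2 := fun t => by
    refine ⟨by positivity, ?_, by nlinarith⟩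
    have := Real.sin_sq_le_one t
    nlinarith [sq_nonneg r]
  have hc : Continuous fun t : ℝ => (1 - r^2 * Real.sin t ^ 2) ^ (-(1:ℝ)/2) := by
    apply Continuous.rpow_const (by fun_prop)
    intro t
    left
    have := hu t
    linarith
  have hI : ∫ t in (0:ℝ)..(π/2), (1 + r^2/2 * sin t^2) = π/2 + π/8*r^2 := by
    rw [intervalIntegral.integral_add (by simp) (Continuous.intervalIntegrable (by fun_prop) _ _),
      intervalIntegral.integral_const_mul, integral_sin_sq]
    simp
    ring
  have hI2 : ∫ t in (0:ℝ)..(π/2), ((1 + r^2/2 * sin t^2) + r^4) = π/2 + π/8*r^2 + r^4*(π/2) := by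
    rw [intervalIntegral.integral_add (Continuous.intervalIntegrable (by fun_prop) _ _) (by simp), hI]
    simp
    ring
  constructor
  · rw [← hI, K]
    apply intervalIntegral.integral_mono_on (by positivity)
      (Continuous.intervalIntegrable (by fun_prop) _ _) (hc.intervalIntegrable _ _)
    intro t _
    have h := hu t
    have := (aux_bound_s13 _ h.1 (h.2.1.trans h.2.2)).1
    linarith
  · rw [← hI2, K]
    apply intervalIntegral.integral_mono_on (by positivity)
      (hc.intervalIntegrable _ _) (Continuous.intervalIntegrable (by fun_prop) _ _)
    intro t _
    have h := hu t
    have := (aux_bound_s13 _ h.1 (h.2.1.trans h.2.2)).2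
    have h4 : (r^2 * sin t^2)^2 ≤ (r^2)^2 := pow_le_pow_left₀ h.1 h.2.1 2
    nlinarith

theorem g₁_tendsto_zero :
    Tendsto g₁ (𝓝[Ioo (0:ℝ) 1] 0) (𝓝 ((128/5 - 32 * Real.log 2 - 17*π/2 + 5*π^2/2))) := by
  have hev : ∀ᶠ r in 𝓝[Ioo (0:ℝ) 1] 0, 0 < r ∧ r < 1/2 := by
    have h1 : ∀ᶠ r in 𝓝[Ioo (0:ℝ) 1] 0, r ∈ Ioo (0:ℝ) 1 := self_mem_nhdsWithin
    have h2 : ∀ᶠ r in 𝓝[Ioo (0:ℝ) 1] 0, r < 1/2 :=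
      nhdsWithin_le_nhds (Iio_mem_nhds (by norm_num))
    filter_upwards [h1, h2] with r a b using ⟨a.1, b⟩
  have hlim : ∀ f : ℝ → ℝ, ContinuousAt f 0 → Tendsto f (𝓝[Ioo (0:ℝ) 1] 0) (𝓝 (f 0)) :=
    fun f hf => hf.tendsto.mono_left nhdsWithin_le_nhds
  have hA : Tendsto (fun r => (K r - π/2) / r^2) (𝓝[Ioo (0:ℝ) 1] 0) (𝓝 (π/8)) := by
    have hup := hlim (fun r => π/8 + r^2 * (π/2)) (by fun_prop)
    simp only [ne_eq, OfNat.ofNat_ne_zero, not_false_eq_true, zero_pow, zero_mul, add_zero] at hup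
    refine tendsto_of_tendsto_of_tendsto_of_le_of_le' tendsto_const_nhds hup ?_ ?_
    · filter_upwards [hev] with r hr
      have := (aux_K r hr.1 hr.2).1
      rw [le_div_iff₀ (pow_pos hr.1 2)]
      linarith
    · filter_upwards [hev] with r hr
      have := (aux_K r hr.1 hr.2).2
      rw [div_le_iff₀ (pow_pos hr.1 2)]
      linarith
  have hB : Tendsto (fun r => Real.log (1 - r^2) / r^2) (𝓝[Ioo (0:ℝ) 1] 0) (𝓝 (-1)) := by
    have hlo := hlim (fun r => -(1 - r^2)⁻¹) (by
      apply ContinuousAt.neg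
      apply ContinuousAt.inv₀ (by fun_prop)
      norm_num)
    rw [show -(1 - (0:ℝ)^2)⁻¹ = -1 by norm_num] at hlo
    refine tendsto_of_tendsto_of_tendsto_of_le_of_le' hlo tendsto_const_nhds ?_ ?_
    · filter_upwards [hev] with r hr
      have hp : 0 < 1 - r^2 := by nlinarith
      have := Real.one_sub_inv_le_log_of_pos hp
      rw [le_div_iff₀ (pow_pos hr.1 2)]
      have e : -(1 - r^2)⁻¹ * r^2 = 1 - (1-r^2)⁻¹ := by
        field_simp
        ring
      linarith
    · filter_upwards [hev] with r hr
      have hp : 0 < 1 - r^2 := by nlinarith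
      have := Real.log_le_sub_one_of_pos hp
      rw [div_le_iff₀ (pow_pos hr.1 2)]
      linarith
  have hC := hlim (fun r => 16 + (5*π - 16) * r^2) (by fun_prop)
  have hT := (((hA.const_add lam).mul hC).add_const ((π/2) * (5*π-16))).add (hB.const_mul (5*π/2))
  have hl : Real.log 4 = 2 * Real.log 2 := by
    rw [show (4:ℝ) = 2^2 by norm_num, Real.log_pow]
    norm_num
  have hval : (lam + π/8) * (16 + (5*π - 16) * 0^2) + (π/2) * (5*π-16) + 5*π/2 * (-1)
      = 128/5 - 32 * Real.log 2 - 17*π/2 + 5*π^2/2 := by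
    rw [lam, hl]
    ring
  rw [← hval]
  refine hT.congr' ?_
  filter_upwards [hev] with r hr
  have := hr.1.ne'
  rw [g₁, g]
  field_simp
  ring
end
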